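/- arXiv:1010.4788 — 3 statements merged into one kernel-verified Lean document; each statement's English description precedes it below -/
import Mathlib

section
/- There is a constant c, depending only on c₁, c₂, Q, δ, c₄, such that for every x ∈ X the fiber Λ⁻¹(x) = {ξ ∈ ∂T : Λ(ξ) = x} is finite with cardinality at most c. -/
open MeasureTheory Set
open scoped ENNReal

/-- A bounded metric measure space `(X, ρ, m)` is Ahlfors `Q`-regular with constants
`c₁ ≤ c₂` if `c₁ r^Q ≤ m(B(x,r)) ≤ c₂ r^Q` for all `x ∈ X` and `0 < r ≤ diam X`. -/
def IsAhlfors {X : Type} [MetricSpace X] [MeasurableSpace X]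
    (m : Measure X) (c₁ c₂ Qd : ℝ) : Prop :=
  ∀ (x : X) (r : ℝ), 0 < r → r ≤ Metric.diam (Set.univ : Set X) →
    ENNReal.ofReal (c₁ * r ^ Qd) ≤ m (Metric.ball x r) ∧
      m (Metric.ball x r) ≤ ENNReal.ofReal (c₂ * r ^ Qd)

/-- A Christ dyadic decomposition of the metric measure space `(X, ρ, m)`. -/
structure ChristDecomposition {X : Type} [MetricSpace X] [MeasurableSpace X]
    (m : Measure X) where
  δ : ℝ
  c₄ : ℝ
  δ_pos : 0 < δ
  δ_lt_one : δ < 1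
  c₄_pos : 0 < c₄
  I : ℕ → Type
  countableI : ∀ k : ℕ, Countable (I k)
  Qs : (k : ℕ) → I k → Set X
  z : (k : ℕ) → I k → X
  isOpenQs : ∀ (k : ℕ) (α : I k), IsOpen (Qs k α)
  root : I 0
  root_unique : ∀ a : I 0, a = root
  root_box : Qs 0 root = Set.univ
  ae_cover : ∀ k : ℕ, m ((⋃ α : I k, Qs k α)ᶜ) = 0
  nested : ∀ ⦃k l : ℕ⦄, k ≤ l → ∀ (α : I k) (β : I l),
      Qs l β ⊆ Qs k α ∨ Disjoint (Qs l β) (Qs k α)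
  parent_unique : ∀ ⦃k l : ℕ⦄, k < l → ∀ β : I l, ∃! α : I k, Qs l β ⊆ Qs k α
  diam_le : ∀ (k : ℕ) (α : I k), Metric.diam (Qs k α) ≤ c₄ * δ ^ k
  ball_subset : ∀ (k : ℕ) (α : I k), Metric.ball (z k α) (δ ^ k) ⊆ Qs k α
  z_mem : ∀ (k : ℕ) (α : I k), z k α ∈ Qs k α

namespace ChristDecomposition

variable {X : Type} [MetricSpace X] [MeasurableSpace X] {m : Measure X}

/-- The vertices of the graph/tree: pairs `(k, α)` with `α ∈ I_k`. -/
def Idx (D : ChristDecomposition m) : Type := Σ k : ℕ, D.I k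

/-- G-adjacency of two indices: either they are at consecutive levels and one of the
corresponding dyadic sets contains the other, or they are at the same level `k` and the
corresponding dyadic sets contain points at distance `≤ δ^k`. -/
def GAdj (D : ChristDecomposition m) (a b : D.Idx) : Prop :=
  a ≠ b ∧
    (((a.1 = b.1 + 1 ∨ b.1 = a.1 + 1) ∧
        (D.Qs a.1 a.2 ⊆ D.Qs b.1 b.2 ∨ D.Qs b.1 b.2 ⊆ D.Qs a.1 a.2)) ∨
      (a.1 = b.1 ∧ ∃ x ∈ D.Qs a.1 a.2, ∃ y ∈ D.Qs b.1 b.2, dist x y ≤ D.δ ^ a.1))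

/-- A branch of the tree: a sequence of nested dyadic sets, one at each level.
This is the boundary `∂T` of the tree `T`. -/
def Branch (D : ChristDecomposition m) : Type :=
  { ξ : (k : ℕ) → D.I k // ∀ k : ℕ, D.Qs (k + 1) (ξ (k + 1)) ⊆ D.Qs k (ξ k) }

-- The map `Λ : ∂T → X` sending a branch to the unique point of `⋂_k closure (Q^k_{ξ_k})`.
open Classical in
noncomputable def Lam (D : ChristDecomposition m) (ξ : D.Branch) : X :=
  if h : (⋂ k : ℕ, closure (D.Qs k (ξ.1 k))).Nonempty then h.choose
  else D.z 0 D.root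

-- The metric `ρ_T` on `∂T`: `ρ_T(ζ,ξ) = (2δ/(1-δ)) δ^{n(ζ,ξ)}`, `n(ζ,ξ) = max {k | ζ_k = ξ_k}`.
open Classical in
noncomputable def rhoT (D : ChristDecomposition m) (ζ ξ : D.Branch) : ℝ :=
  if ζ = ξ then 0
  else (2 * D.δ / (1 - D.δ)) * D.δ ^ sSup {k : ℕ | ζ.1 k = ξ.1 k}

/-- The cylinder `∂S(α) ⊆ ∂T` of branches passing through `α ∈ I_k`. -/
def cyl (D : ChristDecomposition m) (k : ℕ) (α : D.I k) : Set D.Branch :=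
  {ξ : D.Branch | ξ.1 k = α}

/-- `P_G(x)`: the set of indices `α` with `x ∈ closure Q_α`, or `α` G-adjacent to some `β`
with `x ∈ closure Q_β`. -/
def PG (D : ChristDecomposition m) (x : X) : Set D.Idx :=
  {a : D.Idx | x ∈ closure (D.Qs a.1 a.2) ∨
    ∃ b : D.Idx, D.GAdj a b ∧ x ∈ closure (D.Qs b.1 b.2)}

/-- `I_G ω(x) = Σ_{α ∈ P_G(x)} ω(α) m(α)^{-s}`. -/
noncomputable def IG (D : ChristDecomposition m) (s : ℝ) (ω : Measure X) (x : X) : ℝ≥0∞ :=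
  ∑' a : D.PG x, ω (closure (D.Qs a.1.1 a.1.2)) * m (D.Qs a.1.1 a.1.2) ^ (-s)

/-- `S_G ω(x) = sup_{α ∈ P_G(x)} ω(α) m(α)^{-s}`. -/
noncomputable def SG (D : ChristDecomposition m) (s : ℝ) (ω : Measure X) (x : X) : ℝ≥0∞ :=
  ⨆ (a : D.Idx) (_ : a ∈ D.PG x), ω (closure (D.Qs a.1 a.2)) * m (D.Qs a.1 a.2) ^ (-s)

end ChristDecomposition

-- The Riesz-type kernel `K(x,y) = (m(B(x,ρ(x,y))) + m(B(y,ρ(x,y))))^{-s}`, `K(x,x) = ∞`.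
open Classical in
noncomputable def Kker {Y : Type} [MetricSpace Y] [MeasurableSpace Y]
    (μ : Measure Y) (s : ℝ) (x y : Y) : ℝ≥0∞ :=
  if x = y then ⊤
  else (μ (Metric.ball x (dist x y)) + μ (Metric.ball y (dist x y))) ^ (-s)

/-- The potential `Kω(x) = ∫ K(x,y) dω(y)`. -/
noncomputable def Kpot {Y : Type} [MetricSpace Y] [MeasurableSpace Y]
    (μ : Measure Y) (s : ℝ) (ω : Measure Y) (x : Y) : ℝ≥0∞ :=
  ∫⁻ y, Kker μ s x y ∂ω

/-- The `p`-energy `E(ω) = ∫ (Kω)^{p'} dm`, `p' = p/(p-1)`. -/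
noncomputable def energyX {Y : Type} [MetricSpace Y] [MeasurableSpace Y]
    (μ : Measure Y) (s p : ℝ) (ω : Measure Y) : ℝ≥0∞ :=
  ∫⁻ x, Kpot μ s ω x ^ (p / (p - 1)) ∂μ

/-- The `p`-capacity `Cap(E) = sup { ω(E)^p / E(ω)^{p-1} }`, the supremum being over positive
Borel measures supported in `E` with finite positive energy. -/
noncomputable def CapX {Y : Type} [MetricSpace Y] [MeasurableSpace Y]
    (μ : Measure Y) (s p : ℝ) (E : Set Y) : ℝ≥0∞ :=
  ⨆ (ω : Measure Y) (_ : ω Eᶜ = 0) (_ : 0 < energyX μ s p ω)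
    (_ : energyX μ s p ω < ⊤), ω E ^ p / energyX μ s p ω ^ (p - 1)

namespace ChristDecomposition

variable {X : Type} [MetricSpace X] [MeasurableSpace X] {m : Measure X}

/-- The dyadic sets along a branch are decreasing. -/
lemma Branch.antitone (D : ChristDecomposition m) (ξ : D.Branch) :
    Antitone fun k => D.Qs k (ξ.1 k) :=
  antitone_nat_of_succ_le ξ.2

/-- Two branches that differ at some level differ at every higher level. -/
lemma Branch.ne_of_le (D : ChristDecomposition m) {ξ ζ : D.Branch} {k l : ℕ} (hkl : k ≤ l)
    (h : ξ.1 k ≠ ζ.1 k) : ξ.1 l ≠ ζ.1 l := by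
  intro e
  rcases hkl.eq_or_lt with rfl | hlt
  · exact h e
  · refine h ((D.parent_unique hlt (ξ.1 l)).unique (Branch.antitone D ξ hkl) ?_)
    rw [e]
    exact Branch.antitone D ζ hkl

/-- Finitely many branches are separated by all sufficiently high levels. -/
lemma Branch.eventually_injOn (D : ChristDecomposition m) (t : Finset D.Branch) :
    ∀ᶠ k in Filter.atTop, Set.InjOn (fun ξ : D.Branch => ξ.1 k) t := by
  have h : ∀ᶠ k in Filter.atTop, ∀ ξ ∈ t, ∀ ζ ∈ t, ξ.1 k = ζ.1 k → ξ = ζ := by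
    rw [Filter.eventually_all_finset]
    intro ξ _
    rw [Filter.eventually_all_finset]
    intro ζ _
    by_cases hne : ξ = ζ
    · exact Filter.Eventually.of_forall fun _ _ => hne
    · obtain ⟨n, hn⟩ : ∃ n, ξ.1 n ≠ ζ.1 n := by
        by_contra! hall
        exact hne (Subtype.ext (funext hall))
      filter_upwards [Filter.eventually_ge_atTop n] with k hk e
      exact absurd e (Branch.ne_of_le D hk hn)
  filter_upwards [h] with k hk ξ hξ ζ hζ e
  exact hk ξ hξ ζ hζ e

/-- In a bounded complete space, `Λ(ξ)` lies in the closure of every dyadic set of `ξ`. -/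
lemma Lam_mem_closure [CompleteSpace X] (D : ChristDecomposition m)
    (hX : Bornology.IsBounded (Set.univ : Set X)) (ξ : D.Branch) (k : ℕ) :
    D.Lam ξ ∈ closure (D.Qs k (ξ.1 k)) := by
  have hne : (⋂ k : ℕ, closure (D.Qs k (ξ.1 k))).Nonempty := by
    refine Metric.nonempty_iInter_of_nonempty_biInter (fun _ => isClosed_closure)
      (fun n => hX.subset (Set.subset_univ _)) (fun N => ⟨D.z N (ξ.1 N), ?_⟩) ?_
    · refine Set.mem_iInter₂.2 fun n hn => subset_closure ?_
      exact Branch.antitone D ξ hn (D.z_mem N (ξ.1 N))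
    · refine squeeze_zero (fun _ => Metric.diam_nonneg)
        (fun n => (Metric.diam_closure _).trans_le (D.diam_le n (ξ.1 n))) ?_
      simpa using (tendsto_pow_atTop_nhds_zero_of_lt_one D.δ_pos.le D.δ_lt_one).const_mul D.c₄
  rw [Lam, dif_pos hne]
  exact Set.mem_iInter.1 hne.choose_spec k

/-- Dyadic sets of the same level with distinct indices are disjoint, provided nonempty open
sets have positive measure. -/
lemma disjoint_of_ne [m.IsOpenPosMeasure] (D : ChristDecomposition m) {k : ℕ} {α β : D.I k}
    (hne : α ≠ β) : Disjoint (D.Qs k α) (D.Qs k β) := by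
  refine (D.nested le_rfl β α).resolve_left fun hαβ => ?_
  have hpos : m (D.Qs k α) ≠ 0 :=
    ((D.isOpenQs k α).measure_pos m ⟨_, D.z_mem k α⟩).ne'
  obtain ⟨y, hyα, hy⟩ : ∃ y ∈ D.Qs k α, y ∈ ⋃ γ : D.I (k + 1), D.Qs (k + 1) γ := by
    by_contra! h
    exact hpos (measure_mono_null h (D.ae_cover (k + 1)))
  obtain ⟨γ, hγ⟩ := Set.mem_iUnion.1 hy
  have hγα : D.Qs (k + 1) γ ⊆ D.Qs k α :=
    (D.nested k.le_succ α γ).resolve_right (Set.not_disjoint_iff.2 ⟨y, hγ, hyα⟩)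
  exact hne ((D.parent_unique k.lt_succ_self γ).unique hγα (hγα.trans hαβ))

/-- The number of level-`k` dyadic sets whose closure contains a given point is bounded, for
levels `k` whose scale is small compared to the diameter of the space. -/
lemma card_le_of_mem_closure [BorelSpace X] [m.IsOpenPosMeasure] (D : ChristDecomposition m)
    {c₁ c₂ Qd : ℝ} (hm : IsAhlfors m c₁ c₂ Qd) (hc₁ : 0 < c₁) (hc₂ : 0 ≤ c₂)
    (hX : Bornology.IsBounded (Set.univ : Set X)) {x : X} {k : ℕ}
    (hk : (D.c₄ + 1) * D.δ ^ k ≤ Metric.diam (Set.univ : Set X)) (t : Finset (D.I k))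
    (ht : ∀ α ∈ t, x ∈ closure (D.Qs k α)) :
    (t.card : ℝ) ≤ c₂ * (D.c₄ + 1) ^ Qd / c₁ := by
  have hδ : 0 < D.δ ^ k := pow_pos D.δ_pos k
  have hc₄ := D.c₄_pos
  have hlt : D.δ ^ k ≤ (D.c₄ + 1) * D.δ ^ k := by nlinarith
  have hsub : ∀ α ∈ t, D.Qs k α ⊆ Metric.ball x ((D.c₄ + 1) * D.δ ^ k) := by
    intro α hα y hy
    have h₁ : dist y x ≤ Metric.diam (closure (D.Qs k α)) :=
      Metric.dist_le_diam_of_mem (hX.subset (Set.subset_univ _)) (subset_closure hy) (ht α hα)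
    rw [Metric.diam_closure] at h₁
    rw [Metric.mem_ball]
    linarith [D.diam_le k α]
  have hsum : ∑ α ∈ t, m (D.Qs k α) ≤ m (Metric.ball x ((D.c₄ + 1) * D.δ ^ k)) := by
    rw [← measure_biUnion_finset (fun α _ β _ hne => D.disjoint_of_ne hne)
      fun α _ => (D.isOpenQs k α).measurableSet]
    exact measure_mono (Set.iUnion₂_subset hsub)
  have hlow : ∀ α ∈ t, ENNReal.ofReal (c₁ * (D.δ ^ k) ^ Qd) ≤ m (D.Qs k α) := fun α _ =>
    (hm (D.z k α) _ hδ (hlt.trans hk)).1.trans (measure_mono (D.ball_subset k α))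
  have hmain := (Finset.card_nsmul_le_sum t _ _ hlow).trans
    (hsum.trans (hm x _ (hδ.trans_le hlt) hk).2)
  rw [← ENNReal.ofReal_nsmul, ENNReal.ofReal_le_ofReal_iff (by positivity), nsmul_eq_mul,
    Real.mul_rpow (by positivity) hδ.le] at hmain
  have hp : 0 < (D.δ ^ k) ^ Qd := Real.rpow_pos_of_pos hδ Qd
  rw [le_div_iff₀ hc₁]
  refine le_of_mul_le_mul_right ?_ hp
  linarith

end ChristDecomposition

/-- The measure of an Ahlfors regular space is positive on nonempty open sets. -/
lemma IsAhlfors.isOpenPosMeasure {X : Type} [MetricSpace X] [MeasurableSpace X]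
    {m : Measure X} {c₁ c₂ Qd : ℝ} (hm : IsAhlfors m c₁ c₂ Qd) (hc₁ : 0 < c₁)
    (hd : 0 < Metric.diam (Set.univ : Set X)) : m.IsOpenPosMeasure := by
  refine ⟨fun U hU ⟨x, hx⟩ h0 => ?_⟩
  obtain ⟨ε, hε, hball⟩ := Metric.isOpen_iff.1 hU x hx
  have hr : 0 < min ε (Metric.diam (Set.univ : Set X)) := lt_min hε hd
  have hle := (hm x _ hr (min_le_right _ _)).1.trans
    (measure_mono ((Metric.ball_subset_ball (min_le_left _ _)).trans hball))
  rw [h0, nonpos_iff_eq_zero, ENNReal.ofReal_eq_zero] at hle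
  exact absurd hle (not_le.2 (mul_pos hc₁ (Real.rpow_pos_of_pos hr Qd)))

/-- A set whose finite subsets have at most `c` elements is finite with at most `c` elements. -/
lemma Set.finite_and_ncard_le_of_forall_finset {α : Type*} {s : Set α} {c : ℕ}
    (h : ∀ t : Finset α, ↑t ⊆ s → t.card ≤ c) : s.Finite ∧ s.ncard ≤ c := by
  have hfin : s.Finite := by
    by_contra hinf
    obtain ⟨t, hts, htc⟩ := Set.Infinite.exists_subset_card_eq hinf (c + 1)
    exact absurd (h t hts) (by omega)
  refine ⟨hfin, ?_⟩
  rw [Set.ncard_eq_toFinset_card s hfin]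
  exact h _ (by simp)

/-- There is a constant `c`, depending only on `c₁, c₂, Q, δ, c₄`, such that every
fiber `Λ⁻¹(x) = {ξ ∈ ∂T | Λ(ξ) = x}` is finite with cardinality at most `c`. -/
theorem fiber_bounded
    (c₁ c₂ Qd δ c₄ : ℝ) (hc₁ : 0 < c₁) (hc₁₂ : c₁ ≤ c₂) (hQ : 0 < Qd)
    (hδ0 : 0 < δ) (hδ1 : δ < 1) (hc₄ : 0 < c₄) :
    ∃ c : ℕ,
      ∀ (X : Type) [MetricSpace X] [CompleteSpace X] [MeasurableSpace X] [BorelSpace X]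
        (m : Measure X),
        0 < Metric.diam (Set.univ : Set X) → Metric.diam (Set.univ : Set X) ≤ 1 →
        IsAhlfors m c₁ c₂ Qd →
        ∀ D : ChristDecomposition m, D.δ = δ → D.c₄ = c₄ →
          ∀ x : X,
            {ξ : D.Branch | D.Lam ξ = x}.Finite ∧
            {ξ : D.Branch | D.Lam ξ = x}.ncard ≤ c := by
  refine ⟨⌊c₂ * (c₄ + 1) ^ Qd / c₁⌋₊, ?_⟩
  intro X _ _ _ _ m hd _ hm D rfl rfl x
  have hX : Bornology.IsBounded (Set.univ : Set X) := by
    by_contra hb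
    exact hd.ne' (Metric.diam_eq_zero_of_unbounded hb)
  have := hm.isOpenPosMeasure hc₁ hd
  refine Set.finite_and_ncard_le_of_forall_finset fun t ht => Nat.le_floor ?_
  have hlim : Filter.Tendsto (fun k => (D.c₄ + 1) * D.δ ^ k) Filter.atTop (nhds 0) := by
    simpa using (tendsto_pow_atTop_nhds_zero_of_lt_one hδ0.le hδ1).const_mul (D.c₄ + 1)
  obtain ⟨k, hinj, hk⟩ := ((ChristDecomposition.Branch.eventually_injOn D t).and
    (hlim.eventually_le_const hd)).exists
  classical
  rw [← Finset.card_image_of_injOn hinj]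
  refine D.card_le_of_mem_closure hm hc₁ (hc₁.le.trans hc₁₂) hX (x := x) hk _ fun α hα => ?_
  obtain ⟨ξ, hξ, rfl⟩ := Finset.mem_image.1 hα
  have hx : D.Lam ξ = x := ht hξ
  exact hx ▸ D.Lam_mem_closure hX ξ k
end

section
/- There is a constant C(p), depending only on p, such that for every positive finite Borel measure μ on T̄ with [μ] < ∞ and every f : T → [0,∞): ∫_{T̄} (If)^p dμ ≤ C(p) · [μ] · Σ_{x ∈ T} f(x)^p π(x). Conversely, if there is a constant B < ∞ such that ∫_{T̄} (If)^p dμ ≤ B · Σ_{x ∈ T} f(x)^p π(x) for every f : T → [0,∞), then [μ] ≤ B. -/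
open MeasureTheory Set
open scoped ENNReal

/-- A countable rooted tree with at least one and at most `N` children at each vertex. -/
structure PTTree where
  V : Type
  countableV : Countable V
  root : V
  parent : V → V
  parent_root : parent root = root
  reaches_root : ∀ x : V, ∃ n : ℕ, parent^[n] x = root
  N : ℕ
  one_le_N : 1 ≤ N
  child_exists : ∀ x : V, ∃ y : V, parent y = x ∧ y ≠ x
  child_finite : ∀ x : V, {y : V | parent y = x ∧ y ≠ x}.Finite
  child_card : ∀ x : V, {y : V | parent y = x ∧ y ≠ x}.ncard ≤ N

namespace PTTree

/-- The tree order: `x ≤ y` iff `x` is an iterated parent of `y` (or `x = y`). -/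
def le (t : PTTree) (x y : t.V) : Prop := ∃ n : ℕ, t.parent^[n] y = x

/-- The predecessor set `P(x) = {y | y ≤ x}`. -/
def P (t : PTTree) (x : t.V) : Set t.V := {y : t.V | t.le y x}

/-- The successor set `S(x) = {y | y ≥ x}`. -/
def S (t : PTTree) (x : t.V) : Set t.V := {y : t.V | t.le x y}

/-- The boundary `∂T`: half-infinite geodesics starting at the root. -/
def Bdry (t : PTTree) : Type :=
  { ξ : ℕ → t.V // ξ 0 = t.root ∧ ∀ n : ℕ, t.parent (ξ (n + 1)) = ξ n }

/-- `T̄ = T ⊔ ∂T`. -/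
def Tbar (t : PTTree) : Type := t.V ⊕ t.Bdry

/-- Inclusion of vertices in `T̄`. -/
def inV (t : PTTree) (x : t.V) : t.Tbar := Sum.inl x

/-- Inclusion of boundary points in `T̄`. -/
def inB (t : PTTree) (ξ : t.Bdry) : t.Tbar := Sum.inr ξ

/-- `S̄(x) ⊆ T̄`: the successors of `x` together with the boundary geodesics through `x`. -/
def Sbar (t : PTTree) (x : t.V) : Set t.Tbar :=
  {z : t.Tbar |
    Sum.elim (fun y : t.V => t.le x y) (fun ξ : t.Bdry => ∃ n : ℕ, ξ.1 n = x) z}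

/-- The predecessor set `P(ζ) ⊆ T` of a point `ζ ∈ T̄`. -/
def PT (t : PTTree) : t.Tbar → Set t.V :=
  Sum.elim (fun x : t.V => t.P x) (fun ξ : t.Bdry => Set.range ξ.1)

/-- The compact metrizable topology on `T̄`: vertices are isolated and the sets `S̄(x)` form a
neighbourhood basis along `∂T`. -/
def top (t : PTTree) : TopologicalSpace t.Tbar :=
  TopologicalSpace.generateFrom
    ((Set.range fun x : t.V => ({t.inV x} : Set t.Tbar)) ∪ Set.range t.Sbar)

/-- The Borel σ-algebra of `T̄`. -/
def borelT (t : PTTree) : MeasurableSpace t.Tbar := @borel t.Tbar t.top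

/-- The Hardy operator `If(ζ) = Σ_{y ∈ P(ζ)} f(y)`. -/
noncomputable def Ifun (t : PTTree) (f : t.V → ℝ≥0∞) (ζ : t.Tbar) : ℝ≥0∞ :=
  ∑' y : t.PT ζ, f y.1

/-- `I*μ(x) = μ(S̄(x))`. -/
noncomputable def Istar (t : PTTree) (μ : @Measure t.Tbar t.borelT) (x : t.V) : ℝ≥0∞ :=
  μ (t.Sbar x)

/-- `Σ_{x ∈ S(a)} (I*μ(x))^{p'} π(x)^{1-p'}`, with `p' = p/(p-1)`. -/
noncomputable def sigmaSum (t : PTTree) (π : t.V → ℝ) (p : ℝ)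
    (μ : @Measure t.Tbar t.borelT) (a : t.V) : ℝ≥0∞ :=
  ∑' x : t.S a, t.Istar μ x.1 ^ (p / (p - 1)) * ENNReal.ofReal (π x.1) ^ (1 - p / (p - 1))

/-- The Carleson/testing constant
`[μ] = sup_{a : I*μ(a) > 0} (Σ_{x ∈ S(a)} (I*μ(x))^{p'} π(x)^{1-p'} / I*μ(a))^{p-1}`. -/
noncomputable def CC (t : PTTree) (π : t.V → ℝ) (p : ℝ)
    (μ : @Measure t.Tbar t.borelT) : ℝ≥0∞ :=
  ⨆ (a : t.V) (_ : 0 < t.Istar μ a), (t.sigmaSum π p μ a / t.Istar μ a) ^ (p - 1)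

/-- The tree capacity `Cap(E) = inf { Σ_x φ(x)^p π(x) : Iφ ≥ 1 on E }`. -/
noncomputable def Cap (t : PTTree) (π : t.V → ℝ) (p : ℝ) (E : Set t.Tbar) : ℝ≥0∞ :=
  ⨅ (φ : t.V → ℝ≥0∞) (_ : ∀ ζ ∈ E, 1 ≤ t.Ifun φ ζ),
    ∑' x : t.V, φ x ^ p * ENNReal.ofReal (π x)

/-- The potential-theoretic distance from the root
`d_π(ζ) = Σ_{y ∈ P(ζ)} π(y)^{1-p'}`. -/
noncomputable def dpi (t : PTTree) (π : t.V → ℝ) (p : ℝ) (ζ : t.Tbar) : ℝ≥0∞ :=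
  ∑' y : t.PT ζ, ENNReal.ofReal (π y.1) ^ (1 - p / (p - 1))

/-- The tree maximal function `M_μ g(ζ) = sup_{β ∈ P(ζ), μ(S̄(β)) > 0} (∫_{S̄(β)} g dμ) / μ(S̄(β))`. -/
noncomputable def Mfun (t : PTTree) (μ : @Measure t.Tbar t.borelT)
    (g : t.Tbar → ℝ≥0∞) (ζ : t.Tbar) : ℝ≥0∞ :=
  ⨆ (β : t.V) (_ : β ∈ t.PT ζ) (_ : 0 < μ (t.Sbar β)),
    (∫⁻ z in t.Sbar β, g z ∂μ) / μ (t.Sbar β)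

/-- The tree maximal function of a measure,
`M_μ σ(ζ) = sup_{β ∈ P(ζ), μ(S̄(β)) > 0} σ(S̄(β)) / μ(S̄(β))`. -/
noncomputable def Mmeas (t : PTTree) (μ σ : @Measure t.Tbar t.borelT)
    (ζ : t.Tbar) : ℝ≥0∞ :=
  ⨆ (β : t.V) (_ : β ∈ t.PT ζ) (_ : 0 < μ (t.Sbar β)), σ (t.Sbar β) / μ (t.Sbar β)

end PTTree

namespace ENNReal

/-- The tangent line inequality for the convex function `x ↦ x ^ p`. -/
theorem add_rpow_le_rpow_add_mul {p : ℝ} (hp : 1 ≤ p) {b d : ℝ≥0∞} (hb : b ≠ ⊤) (hd : d ≠ ⊤) :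
    (b + d) ^ p ≤ b ^ p + ENNReal.ofReal p * (b + d) ^ (p - 1) * d := by
  have hp0 : 0 ≤ p := by linarith
  have hp1 : 0 ≤ p - 1 := by linarith
  lift b to NNReal using hb
  lift d to NNReal using hd
  rcases eq_or_ne (b + d) 0 with h | h
  · have hb0 : b = 0 := by simpa using le_of_le_of_eq le_self_add h
    have hd0 : d = 0 := by simpa using le_of_le_of_eq le_add_self h
    subst hb0 hd0
    simp [ENNReal.zero_rpow_of_pos (by linarith : 0 < p)]
  · rw [← ENNReal.ofNNReal_toNNReal p, ← ENNReal.coe_add, ← ENNReal.coe_rpow_of_nonneg _ hp0,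
      ← ENNReal.coe_rpow_of_nonneg _ hp0, ← ENNReal.coe_rpow_of_nonneg _ hp1]
    norm_cast
    rw [← NNReal.coe_le_coe]
    push_cast
    rw [Real.coe_toNNReal _ hp0]
    have hpos : (0 : ℝ) < b + d := by exact_mod_cast pos_iff_ne_zero.2 h
    have hd0 : (0 : ℝ) ≤ d := d.2
    have hb0 : (0 : ℝ) ≤ b := b.2
    have hs : -1 ≤ -(d : ℝ) / (b + d) := by
      rw [le_div_iff₀ hpos]; linarith
    have key := one_add_mul_self_le_rpow_one_add hs hp
    have h1 : 1 + -(d : ℝ) / (b + d) = b / (b + d) := by field_simp; ring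
    rw [h1, Real.div_rpow hb0 hpos.le, le_div_iff₀ (Real.rpow_pos_of_pos hpos p)] at key
    have h2 : ((b : ℝ) + d) ^ p = (b + d) ^ (p - 1) * (b + d) := by
      rw [← Real.rpow_add_one hpos.ne']; simp
    have h3 : (1 + p * (-(d : ℝ) / (b + d))) * (b + d) ^ p
        = (b + d) ^ p - p * (b + d) ^ (p - 1) * d := by
      rw [h2]; field_simp; ring
    linarith

theorem le_rpow_of_le_mul_rpow {p q : ℝ} (hpq : p.HolderConjugate q) {A c : ℝ≥0∞} (hA : A ≠ ⊤)
    (h : A ≤ c * A ^ (1 / q)) : A ≤ c ^ p := by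
  rcases eq_or_ne A 0 with rfl | h0
  · exact zero_le
  have hA' : A ^ (1 / p) * A ^ (1 / q) = A := by
    rw [← ENNReal.rpow_add _ _ h0 hA, hpq.one_div_add_one_div, one_div_one, ENNReal.rpow_one]
  have hle : A ^ p⁻¹ ≤ c := by
    rw [← one_div]
    refine (ENNReal.mul_le_mul_iff_left (c := A ^ (1 / q))
      (ENNReal.rpow_pos (pos_iff_ne_zero.2 h0) hA).ne'
      (ENNReal.rpow_ne_top_of_ne_zero h0 hA)).1 ?_
    rwa [hA']
  exact (ENNReal.rpow_inv_le_iff hpq.pos).1 hle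

end ENNReal

namespace PTTree

section

attribute [local instance] PTTree.borelT PTTree.countableV

variable {t : PTTree} {f : t.V → ℝ≥0∞} {ζ : t.Tbar} {x y a : t.V}

theorem mem_PT_iff : x ∈ t.PT ζ ↔ ζ ∈ t.Sbar x := by
  cases ζ <;> rfl

theorem mem_PT_inV : y ∈ t.PT (t.inV x) ↔ t.le y x := Iff.rfl

theorem le_trans' {z : t.V} (h : t.le x y) (h' : t.le y z) : t.le x z := by
  obtain ⟨m, rfl⟩ := h
  obtain ⟨n, rfl⟩ := h'
  exact ⟨m + n, Function.iterate_add_apply ..⟩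

theorem iterate_parent_bdry (ξ : t.Bdry) (n k : ℕ) : t.parent^[k] (ξ.1 n) = ξ.1 (n - k) := by
  induction k with
  | zero => rfl
  | succ k ih =>
    rw [Function.iterate_succ_apply', ih]
    rcases h : n - k with _ | m
    · rw [ξ.2.1, t.parent_root, show n - (k + 1) = 0 by omega, ξ.2.1]
    · rw [ξ.2.2, show n - (k + 1) = m by omega]

theorem mem_PT_of_le (h : t.le x y) (hy : y ∈ t.PT ζ) : x ∈ t.PT ζ := by
  cases ζ with
  | inl z => exact le_trans' h hy
  | inr ξ =>
    obtain ⟨n, rfl⟩ := hy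
    obtain ⟨k, rfl⟩ := h
    exact ⟨n - k, (iterate_parent_bdry ξ n k).symm⟩

theorem Sbar_subset (h : t.le x y) : t.Sbar y ⊆ t.Sbar x := fun _ hz =>
  mem_PT_iff.1 (mem_PT_of_le h (mem_PT_iff.2 hz))

/-- A point of `T̄` has the same predecessors in a given finite set as some vertex. -/
theorem exists_vertex_same_predecessors (F : Finset t.V) (ζ : t.Tbar) :
    ∃ x : t.V, ∀ y ∈ F, y ∈ t.PT ζ ↔ y ∈ t.PT (t.inV x) := by
  cases ζ with
  | inl x => exact ⟨x, fun _ _ => Iff.rfl⟩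
  | inr ξ =>
    classical
    have h : ∀ y : t.V, ∃ m, y ∈ range ξ.1 → ξ.1 m = y := fun y => by
      by_cases hy : y ∈ range ξ.1
      · exact hy.imp fun m hm _ => hm
      · exact ⟨0, fun h => absurd h hy⟩
    choose m hm using h
    refine ⟨ξ.1 (F.sup m), fun y hy => ⟨fun hyξ => ?_, fun hyx => ?_⟩⟩
    · refine ⟨F.sup m - m y, ?_⟩
      rw [iterate_parent_bdry, Nat.sub_sub_self (Finset.le_sup hy)]
      exact hm y hyξ
    · exact mem_PT_of_le (ζ := Sum.inr ξ) hyx (mem_range_self _)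

theorem iterate_parent_root (n : ℕ) : t.parent^[n] t.root = t.root :=
  Function.iterate_fixed t.parent_root n

theorem not_le_parent (hx : x ≠ t.root) : ¬ t.le x (t.parent x) := by
  rintro ⟨k, hk⟩
  obtain ⟨n, hn⟩ := t.reaches_root x
  have hfix : t.parent^[k + 1] x = x := hk
  have h1 : t.parent^[(k + 1) * n] x = x := by
    rw [Function.iterate_mul]
    exact Function.iterate_fixed hfix n
  apply hx
  rw [← h1, show (k + 1) * n = k * n + n by ring, Function.iterate_add_apply, hn,
    iterate_parent_root]

theorem le_iff_eq_or_le_parent : t.le y x ↔ y = x ∨ t.le y (t.parent x) := by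
  constructor
  · rintro ⟨_ | k, rfl⟩
    · exact Or.inl rfl
    · exact Or.inr ⟨k, rfl⟩
  · rintro (rfl | ⟨k, rfl⟩)
    · exact ⟨0, rfl⟩
    · exact ⟨k + 1, rfl⟩

theorem le_root_iff : t.le y t.root ↔ y = t.root := by
  constructor
  · rintro ⟨k, rfl⟩
    exact iterate_parent_root k
  · rintro rfl
    exact ⟨0, rfl⟩

theorem Ifun_eq_tsum_indicator (f : t.V → ℝ≥0∞) (ζ : t.Tbar) :
    t.Ifun f ζ = ∑' x, (t.PT ζ).indicator f x :=
  tsum_subtype (t.PT ζ) f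

theorem Ifun_eq_tsum_Sbar (f : t.V → ℝ≥0∞) (ζ : t.Tbar) :
    t.Ifun f ζ = ∑' x, (t.Sbar x).indicator (fun _ => f x) ζ := by
  rw [Ifun_eq_tsum_indicator]
  refine tsum_congr fun x => ?_
  by_cases h : x ∈ t.PT ζ
  · rw [indicator_of_mem h, indicator_of_mem (mem_PT_iff.1 h)]
  · rw [indicator_of_notMem h, indicator_of_notMem (mt mem_PT_iff.2 h)]

theorem Ifun_root (f : t.V → ℝ≥0∞) : t.Ifun f (t.inV t.root) = f t.root := by
  rw [Ifun_eq_tsum_indicator, tsum_eq_single t.root]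
  · exact indicator_of_mem (mem_PT_inV.2 (le_root_iff.2 rfl)) _
  · exact fun y hy => indicator_of_notMem (fun h => hy (le_root_iff.1 (mem_PT_inV.1 h))) _

theorem Ifun_eq_Ifun_parent_add (f : t.V → ℝ≥0∞) (hx : x ≠ t.root) :
    t.Ifun f (t.inV x) = t.Ifun f (t.inV (t.parent x)) + f x := by
  have hPT : t.PT (t.inV x) = t.PT (t.inV (t.parent x)) ∪ {x} := by
    ext y
    rw [mem_union, mem_singleton_iff, mem_PT_inV, mem_PT_inV, le_iff_eq_or_le_parent, or_comm]
  have hd : Disjoint (t.PT (t.inV (t.parent x))) {x} :=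
    disjoint_singleton_right.2 (not_le_parent hx)
  rw [Ifun_eq_tsum_indicator, Ifun_eq_tsum_indicator, hPT, indicator_union_of_disjoint hd,
    ENNReal.tsum_add, ← tsum_subtype {x} f, tsum_singleton]

open Classical in
/-- The value of `If` at the parent of `x`, with the convention that it vanishes at the root. -/
noncomputable def parentIfun (t : PTTree) (f : t.V → ℝ≥0∞) (x : t.V) : ℝ≥0∞ :=
  if x = t.root then 0 else t.Ifun f (t.inV (t.parent x))

theorem Ifun_inV (f : t.V → ℝ≥0∞) (x : t.V) :
    t.Ifun f (t.inV x) = t.parentIfun f x + f x := by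
  unfold parentIfun
  split_ifs with h
  · rw [h, Ifun_root, zero_add]
  · exact Ifun_eq_Ifun_parent_add f h

/-- The increment of `(If) ^ p` from the parent of `x` to `x`. -/
noncomputable def rpowIncrement (t : PTTree) (p : ℝ) (f : t.V → ℝ≥0∞) (x : t.V) : ℝ≥0∞ :=
  t.Ifun f (t.inV x) ^ p - t.parentIfun f x ^ p

theorem rpowIncrement_eq_zero {p : ℝ} (hx : f x = 0) : t.rpowIncrement p f x = 0 := by
  rw [rpowIncrement, Ifun_inV, hx, add_zero, tsub_self]

theorem parentIfun_rpow_add_rpowIncrement {p : ℝ} (hp : 0 ≤ p) (f : t.V → ℝ≥0∞) (x : t.V) :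
    t.parentIfun f x ^ p + t.rpowIncrement p f x = t.Ifun f (t.inV x) ^ p :=
  add_tsub_cancel_of_le (ENNReal.rpow_le_rpow (by rw [Ifun_inV]; exact le_self_add) hp)

theorem rpowIncrement_le {p : ℝ} (hp : 1 ≤ p) (h : t.Ifun f (t.inV x) ≠ ⊤) :
    t.rpowIncrement p f x ≤ ENNReal.ofReal p * t.Ifun f (t.inV x) ^ (p - 1) * f x := by
  rw [Ifun_inV] at h
  rw [rpowIncrement, tsub_le_iff_left, Ifun_inV]
  exact ENNReal.add_rpow_le_rpow_add_mul hp (ENNReal.add_ne_top.1 h).1 (ENNReal.add_ne_top.1 h).2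

theorem Ifun_rpowIncrement_inV {p : ℝ} (hp : 0 < p) (f : t.V → ℝ≥0∞) (x : t.V) :
    t.Ifun (t.rpowIncrement p f) (t.inV x) = t.Ifun f (t.inV x) ^ p := by
  obtain ⟨n, hn⟩ := t.reaches_root x
  induction n generalizing x with
  | zero =>
    obtain rfl : x = t.root := hn
    rw [Ifun_root, rpowIncrement, parentIfun, if_pos rfl, ENNReal.zero_rpow_of_pos hp, tsub_zero]
  | succ n ih =>
    rcases eq_or_ne x t.root with rfl | hx
    · exact ih _ (iterate_parent_root n)
    · rw [Ifun_eq_Ifun_parent_add _ hx, ih _ hn, ← parentIfun_rpow_add_rpowIncrement hp.le f x,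
        parentIfun, if_neg hx]

theorem Ifun_congr_of_support {F : Finset t.V} (hf : ∀ y ∉ F, f y = 0)
    (h : ∀ y ∈ F, y ∈ t.PT ζ ↔ y ∈ t.PT (t.inV x)) : t.Ifun f ζ = t.Ifun f (t.inV x) := by
  rw [Ifun_eq_tsum_indicator, Ifun_eq_tsum_indicator]
  refine tsum_congr fun y => ?_
  by_cases hy : y ∈ F
  · by_cases hζ : y ∈ t.PT ζ
    · rw [indicator_of_mem hζ, indicator_of_mem ((h y hy).1 hζ)]
    · rw [indicator_of_notMem hζ, indicator_of_notMem (mt (h y hy).2 hζ)]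
  · simp [indicator, hf y hy]

theorem Ifun_rpowIncrement {p : ℝ} (hp : 0 < p) {F : Finset t.V} (hf : ∀ y ∉ F, f y = 0)
    (ζ : t.Tbar) : t.Ifun (t.rpowIncrement p f) ζ = t.Ifun f ζ ^ p := by
  obtain ⟨x, hx⟩ := exists_vertex_same_predecessors F ζ
  rw [Ifun_congr_of_support hf hx, ← Ifun_rpowIncrement_inV hp,
    Ifun_congr_of_support (fun y hy => rpowIncrement_eq_zero (hf y hy)) hx]

theorem measurableSet_Sbar (x : t.V) : MeasurableSet (t.Sbar x) :=
  MeasurableSpace.measurableSet_generateFrom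
    (TopologicalSpace.isOpen_generateFrom_of_mem (Or.inr (mem_range_self x)))

theorem measurable_Ifun (f : t.V → ℝ≥0∞) : Measurable (t.Ifun f) := by
  rw [show t.Ifun f = fun ζ => ∑' x, (t.Sbar x).indicator (fun _ => f x) ζ from
    funext (Ifun_eq_tsum_Sbar f)]
  exact Measurable.tsum fun x => measurable_const.indicator (measurableSet_Sbar x)

theorem lintegral_Ifun (μ : Measure t.Tbar) (f : t.V → ℝ≥0∞) :
    ∫⁻ ζ, t.Ifun f ζ ∂μ = ∑' x, f x * t.Istar μ x := by
  simp_rw [Ifun_eq_tsum_Sbar]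
  rw [lintegral_tsum fun x => (measurable_const.indicator (measurableSet_Sbar x)).aemeasurable]
  exact tsum_congr fun x => lintegral_indicator_const (measurableSet_Sbar x) _

theorem Istar_anti {μ : Measure t.Tbar} (h : t.le x y) : t.Istar μ y ≤ t.Istar μ x :=
  measure_mono (Sbar_subset h)

theorem sigmaSum_eq_zero {π : t.V → ℝ} {p : ℝ} (hp : 1 < p) {μ : Measure t.Tbar}
    (ha : t.Istar μ a = 0) : t.sigmaSum π p μ a = 0 := by
  have hq : 0 < p / (p - 1) := div_pos (by linarith) (by linarith)
  refine ENNReal.tsum_eq_zero.2 fun x => ?_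
  have hx : t.Istar μ x.1 = 0 := le_antisymm ((Istar_anti x.2).trans_eq ha) zero_le
  rw [hx, ENNReal.zero_rpow_of_pos hq, zero_mul]

theorem sigmaSum_le {π : t.V → ℝ} {p : ℝ} (hp : 1 < p) (μ : Measure t.Tbar) [IsFiniteMeasure μ]
    (a : t.V) : t.sigmaSum π p μ a ≤ t.CC π p μ ^ (p - 1)⁻¹ * t.Istar μ a := by
  rcases eq_or_ne (t.Istar μ a) 0 with ha | ha
  · rw [sigmaSum_eq_zero hp ha]
    exact zero_le
  · rw [← ENNReal.div_le_iff ha (measure_ne_top μ _), ENNReal.le_rpow_inv_iff (by linarith)]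
    exact le_iSup₂_of_le a (pos_iff_ne_zero.2 ha) le_rfl

/-- Summation by parts on the tree. -/
theorem tsum_Ifun_mul (d : t.V → ℝ≥0∞) (π : t.V → ℝ) (p : ℝ) (μ : Measure t.Tbar) :
    ∑' x, t.Ifun d (t.inV x) *
      (t.Istar μ x ^ (p / (p - 1)) * ENNReal.ofReal (π x) ^ (1 - p / (p - 1))) =
      ∑' y, d y * t.sigmaSum π p μ y := by
  simp_rw [Ifun_eq_tsum_indicator, ← ENNReal.tsum_mul_right, sigmaSum]
  rw [ENNReal.tsum_comm]
  refine tsum_congr fun y => ?_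
  rw [tsum_subtype (t.S y)
    (fun x => t.Istar μ x ^ (p / (p - 1)) * ENNReal.ofReal (π x) ^ (1 - p / (p - 1))),
    ← ENNReal.tsum_mul_left]
  refine tsum_congr fun x => ?_
  by_cases h : t.le y x
  · rw [indicator_of_mem (mem_PT_inV.2 h), indicator_of_mem (show x ∈ t.S y from h)]
  · rw [indicator_of_notMem (mt mem_PT_inV.1 h), indicator_of_notMem (show x ∉ t.S y from h),
      zero_mul, mul_zero]

theorem Ifun_le_tsum (f : t.V → ℝ≥0∞) (ζ : t.Tbar) : t.Ifun f ζ ≤ ∑' x, f x :=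
  ENNReal.tsum_comp_le_tsum_of_injective Subtype.val_injective f

/-- Hölder's inequality on the tree, with the weight `π` split between the two factors. -/
theorem sum_mul_Istar_le {π : t.V → ℝ} (hπ : ∀ x, 0 < π x) {p : ℝ} (hp : 1 < p)
    (μ : Measure t.Tbar) (f u : t.V → ℝ≥0∞) (F : Finset t.V) :
    ∑ x ∈ F, u x ^ (p - 1) * f x * t.Istar μ x ≤
      (∑ x ∈ F, f x ^ p * ENNReal.ofReal (π x)) ^ (1 / p) *
        (∑ x ∈ F, u x ^ p * (t.Istar μ x ^ (p / (p - 1)) *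
          ENNReal.ofReal (π x) ^ (1 - p / (p - 1)))) ^ (1 / (p / (p - 1))) := by
  have hp1 : 0 < p - 1 := by linarith
  have hpq : p.HolderConjugate (p / (p - 1)) := Real.HolderConjugate.conjExponent hp
  have hq := hpq.symm.pos
  have hw0 : ∀ x, ENNReal.ofReal (π x) ≠ 0 := fun x => (ENNReal.ofReal_pos.2 (hπ x)).ne'
  convert ENNReal.inner_le_Lp_mul_Lq F (fun x => f x * ENNReal.ofReal (π x) ^ (1 / p))
    (fun x => u x ^ (p - 1) * (t.Istar μ x * ENNReal.ofReal (π x) ^ (-(1 / p)))) hpq using 1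
  · refine Finset.sum_congr rfl fun x _ => ?_
    have h1 : ENNReal.ofReal (π x) ^ (1 / p) * ENNReal.ofReal (π x) ^ (-(1 / p)) = 1 := by
      rw [← ENNReal.rpow_add _ _ (hw0 x) ENNReal.ofReal_ne_top, add_neg_cancel, ENNReal.rpow_zero]
    calc u x ^ (p - 1) * f x * t.Istar μ x
        = u x ^ (p - 1) * f x * t.Istar μ x *
          (ENNReal.ofReal (π x) ^ (1 / p) * ENNReal.ofReal (π x) ^ (-(1 / p))) := by
          rw [h1, mul_one]
      _ = _ := by ring
  · congr 2
    · refine Finset.sum_congr rfl fun x _ => ?_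
      rw [ENNReal.mul_rpow_of_nonneg _ _ hpq.nonneg, ← ENNReal.rpow_mul,
        one_div_mul_cancel hpq.ne_zero, ENNReal.rpow_one]
    · refine Finset.sum_congr rfl fun x _ => ?_
      rw [ENNReal.mul_rpow_of_nonneg _ _ hq.le, ENNReal.mul_rpow_of_nonneg _ _ hq.le,
        ← ENNReal.rpow_mul, ← ENNReal.rpow_mul,
        show (p - 1) * (p / (p - 1)) = p by field_simp,
        show -(1 / p) * (p / (p - 1)) = 1 - p / (p - 1) by field_simp; ring]

theorem lintegral_Ifun_rpow_le_of_finite_support {π : t.V → ℝ} (hπ : ∀ x, 0 < π x) {p : ℝ}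
    (hp : 1 < p) (μ : Measure t.Tbar) [IsFiniteMeasure μ] {F : Finset t.V}
    (hF : ∀ y ∉ F, f y = 0) (hf : ∀ y, f y ≠ ⊤) {K : ℝ≥0∞}
    (hK : ∀ a, t.sigmaSum π p μ a ≤ K * t.Istar μ a) :
    ∫⁻ ζ, t.Ifun f ζ ^ p ∂μ ≤
      ENNReal.ofReal (p ^ p) * K ^ (p - 1) * ∑' x, f x ^ p * ENNReal.ofReal (π x) := by
  have hp0 : 0 < p := by linarith
  have hp1 : 0 < p - 1 := by linarith
  have hpq : p.HolderConjugate (p / (p - 1)) := Real.HolderConjugate.conjExponent hp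
  have hq := hpq.symm.pos
  set A := ∫⁻ ζ, t.Ifun f ζ ^ p ∂μ with hAdef
  set S := ∑' x, f x ^ p * ENNReal.ofReal (π x)
  have hsum : ∑' x, f x ≠ ⊤ := by
    rw [tsum_eq_sum hF]
    exact ENNReal.sum_ne_top.2 fun x _ => hf x
  have hI : ∀ ζ, t.Ifun f ζ ≠ ⊤ := fun ζ => ne_top_of_le_ne_top hsum (Ifun_le_tsum f ζ)
  have hA : A ≠ ⊤ := by
    refine ne_top_of_le_ne_top ?_
      (lintegral_mono fun ζ => ENNReal.rpow_le_rpow (Ifun_le_tsum f ζ) hp0.le)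
    rw [lintegral_const]
    exact ENNReal.mul_ne_top (ENNReal.rpow_ne_top_of_nonneg hp0.le hsum) (measure_ne_top μ _)
  have hAincr : A = ∑' x, t.rpowIncrement p f x * t.Istar μ x := by
    simp_rw [hAdef, ← lintegral_Ifun, Ifun_rpowIncrement hp0 hF]
  have hcarleson : ∑ x ∈ F, t.Ifun f (t.inV x) ^ p * (t.Istar μ x ^ (p / (p - 1)) *
      ENNReal.ofReal (π x) ^ (1 - p / (p - 1))) ≤ K * A := by
    refine (ENNReal.sum_le_tsum F).trans ?_
    simp_rw [← Ifun_rpowIncrement_inV hp0]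
    rw [tsum_Ifun_mul, hAincr, ← ENNReal.tsum_mul_left]
    refine ENNReal.tsum_le_tsum fun y => ?_
    rw [mul_left_comm]
    exact mul_le_mul_right (hK y) _
  have hmain : A ≤ (ENNReal.ofReal p * S ^ (1 / p) * K ^ (1 / (p / (p - 1)))) *
      A ^ (1 / (p / (p - 1))) := by
    calc A = ∑ x ∈ F, t.rpowIncrement p f x * t.Istar μ x := by
          rw [hAincr, tsum_eq_sum fun y hy => by rw [rpowIncrement_eq_zero (hF y hy), zero_mul]]
      _ ≤ ∑ x ∈ F, ENNReal.ofReal p * (t.Ifun f (t.inV x) ^ (p - 1) * f x * t.Istar μ x) := by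
          refine Finset.sum_le_sum fun x _ => ?_
          rw [← mul_assoc, ← mul_assoc]
          exact mul_le_mul_left (rpowIncrement_le hp.le (hI _)) _
      _ ≤ ENNReal.ofReal p * (S ^ (1 / p) * (K * A) ^ (1 / (p / (p - 1)))) := by
          rw [← Finset.mul_sum]
          refine mul_le_mul_right ((sum_mul_Istar_le hπ hp μ f _ F).trans ?_) _
          exact mul_le_mul' (ENNReal.rpow_le_rpow (ENNReal.sum_le_tsum F) (by positivity))
            (ENNReal.rpow_le_rpow hcarleson (by positivity))
      _ = _ := by
          rw [ENNReal.mul_rpow_of_nonneg _ _ (by positivity)]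
          ring
  refine (ENNReal.le_rpow_of_le_mul_rpow hpq hA hmain).trans_eq ?_
  rw [ENNReal.mul_rpow_of_nonneg _ _ hp0.le, ENNReal.mul_rpow_of_nonneg _ _ hp0.le,
    ← ENNReal.rpow_mul, ← ENNReal.rpow_mul, one_div_mul_cancel hp0.ne', ENNReal.rpow_one,
    ENNReal.ofReal_rpow_of_pos hp0, show 1 / (p / (p - 1)) * p = p - 1 by field_simp]
  ring

/-- The Hardy operator commutes with increasing limits. -/
theorem Ifun_iSup {f : ℕ → t.V → ℝ≥0∞} (hf : Monotone f) (ζ : t.Tbar) :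
    t.Ifun (fun x => ⨆ n, f n x) ζ = ⨆ n, t.Ifun (f n) ζ := by
  simp only [Ifun, ENNReal.tsum_eq_iSup_sum]
  rw [iSup_comm]
  exact iSup_congr fun s => ENNReal.finsetSum_iSup_of_monotone fun x m n h => hf h x

theorem lintegral_Ifun_rpow_iSup {f : ℕ → t.V → ℝ≥0∞} (hf : Monotone f) {p : ℝ} (hp : 0 < p)
    (μ : Measure t.Tbar) :
    ∫⁻ ζ, t.Ifun (fun x => ⨆ n, f n x) ζ ^ p ∂μ = ⨆ n, ∫⁻ ζ, t.Ifun (f n) ζ ^ p ∂μ := by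
  rw [← lintegral_iSup (fun n => (measurable_Ifun (f n)).pow_const p)]
  · refine lintegral_congr fun ζ => ?_
    rw [Ifun_iSup hf]
    exact (ENNReal.orderIsoRpow p hp).map_iSup _
  · exact fun m n h ζ =>
      ENNReal.rpow_le_rpow (ENNReal.tsum_le_tsum fun x => hf h x.1) hp.le

/-- Every function on a countable type is an increasing limit of finite-valued functions with
finite support. -/
theorem exists_monotone_finite_support_iSup_eq {α : Type*} [Countable α] (f : α → ℝ≥0∞) :
    ∃ F : ℕ → α → ℝ≥0∞, Monotone F ∧ (∀ x, ⨆ n, F n x = f x) ∧ (∀ n x, F n x ≠ ⊤) ∧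
      ∀ n, ∃ s : Finset α, ∀ x ∉ s, F n x = 0 := by
  classical
  obtain ⟨e, he⟩ := Countable.exists_injective_nat α
  refine ⟨fun n x => if e x ≤ n then min (f x) n else 0, fun m n h x => ?_, fun x => ?_,
    fun n x => ?_, fun n => ?_⟩
  · dsimp only
    split_ifs with h1 h2
    · exact min_le_min le_rfl (by exact_mod_cast h)
    · omega
    · exact zero_le
    · exact le_rfl
  · apply le_antisymm
    · refine iSup_le fun n => ?_
      dsimp only
      split_ifs
      exacts [min_le_left _ _, zero_le]
    · refine le_of_forall_lt fun c hc => ?_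
      obtain ⟨n, hn⟩ := ENNReal.exists_nat_gt hc.ne_top
      refine lt_of_lt_of_le ?_ (le_iSup _ (max (e x) n))
      dsimp only
      rw [if_pos (le_max_left _ _)]
      exact lt_min hc (hn.trans_le (by exact_mod_cast le_max_right _ _))
  · dsimp only
    split_ifs
    · exact ne_top_of_le_ne_top (ENNReal.natCast_ne_top n) (min_le_right _ _)
    · exact ENNReal.zero_ne_top
  · refine ⟨((finite_Iic n).preimage he.injOn).toFinset, fun x hx => if_neg fun h => hx ?_⟩
    simpa using h

theorem lintegral_Ifun_rpow_le {π : t.V → ℝ} (hπ : ∀ x, 0 < π x) {p : ℝ} (hp : 1 < p)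
    (μ : Measure t.Tbar) [IsFiniteMeasure μ] (f : t.V → ℝ≥0∞) :
    ∫⁻ ζ, t.Ifun f ζ ^ p ∂μ ≤
      ENNReal.ofReal (p ^ p) * t.CC π p μ * ∑' x, f x ^ p * ENNReal.ofReal (π x) := by
  have hp0 : 0 < p := by linarith
  obtain ⟨F, hmono, hsup, htop, hfin⟩ := exists_monotone_finite_support_iSup_eq f
  obtain rfl : (fun x => ⨆ n, F n x) = f := funext hsup
  rw [lintegral_Ifun_rpow_iSup hmono hp0]
  refine iSup_le fun n => ?_
  obtain ⟨s, hs⟩ := hfin n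
  refine (lintegral_Ifun_rpow_le_of_finite_support hπ hp μ hs (htop n) (sigmaSum_le hp μ)).trans ?_
  rw [ENNReal.rpow_inv_rpow (by linarith)]
  gcongr with x
  exact le_iSup (fun n => F n x) n

theorem sum_rpow_div_le_of_lintegral_le {π : t.V → ℝ} (hπ : ∀ x, 0 < π x) {p : ℝ} (hp : 1 < p)
    (μ : Measure t.Tbar) [IsFiniteMeasure μ] {B : ℝ≥0∞}
    (h : ∀ f : t.V → ℝ≥0∞,
      ∫⁻ ζ, t.Ifun f ζ ^ p ∂μ ≤ B * ∑' x, f x ^ p * ENNReal.ofReal (π x))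
    {F : Finset t.V} (hF : ∀ x ∈ F, t.le a x) :
    ∑ x ∈ F, t.Istar μ x ^ (p / (p - 1)) * ENNReal.ofReal (π x) ^ (1 - p / (p - 1)) ≤
      t.Istar μ a * B ^ (p - 1)⁻¹ := by
  classical
  have hp0 : 0 < p := by linarith
  have hp1 : 0 < p - 1 := by linarith
  have hpq : p.HolderConjugate (p / (p - 1)) := Real.HolderConjugate.conjExponent hp
  have hq := hpq.symm.pos
  have hw0 : ∀ x, ENNReal.ofReal (π x) ≠ 0 := fun x => (ENNReal.ofReal_pos.2 (hπ x)).ne'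
  set σ : t.V → ℝ≥0∞ :=
    fun x => t.Istar μ x ^ (p / (p - 1)) * ENNReal.ofReal (π x) ^ (1 - p / (p - 1)) with hσ
  set f : t.V → ℝ≥0∞ := fun x => if x ∈ F then
    t.Istar μ x ^ (p / (p - 1) - 1) * ENNReal.ofReal (π x) ^ (1 - p / (p - 1)) else 0 with hf
  have hq1 : 0 < p / (p - 1) - 1 := by
    rw [show p / (p - 1) - 1 = 1 / (p - 1) by field_simp; ring]; positivity
  have henergy : ∑' x, f x ^ p * ENNReal.ofReal (π x) = ∑ x ∈ F, σ x := by
    rw [tsum_eq_sum (s := F)]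
    · refine Finset.sum_congr rfl fun x hx => ?_
      rw [hf, hσ]
      dsimp only
      rw [if_pos hx, ENNReal.mul_rpow_of_nonneg _ _ hp0.le, ← ENNReal.rpow_mul,
        ← ENNReal.rpow_mul, mul_assoc]
      have hw : ENNReal.ofReal (π x) ^ ((1 - p / (p - 1)) * p) * ENNReal.ofReal (π x) =
          ENNReal.ofReal (π x) ^ (1 - p / (p - 1)) := by
        conv_lhs => enter [2]; rw [← ENNReal.rpow_one (ENNReal.ofReal (π x))]
        rw [← ENNReal.rpow_add _ _ (hw0 x) ENNReal.ofReal_ne_top,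
          show (1 - p / (p - 1)) * p + 1 = 1 - p / (p - 1) by field_simp; ring]
      rw [hw, show (p / (p - 1) - 1) * p = p / (p - 1) by field_simp; ring]
    · intro x hx
      rw [hf]
      dsimp only
      rw [if_neg hx, ENNReal.zero_rpow_of_pos hp0, zero_mul]
  have hmass : ∫⁻ ζ, t.Ifun f ζ ∂μ = ∑ x ∈ F, σ x := by
    rw [lintegral_Ifun, tsum_eq_sum (s := F)]
    · refine Finset.sum_congr rfl fun x hx => ?_
      rw [hf, hσ]
      dsimp only
      rw [if_pos hx, mul_right_comm]
      nth_rewrite 2 [← ENNReal.rpow_one (t.Istar μ x)]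
      rw [← ENNReal.rpow_add_of_nonneg _ _ hq1.le zero_le_one, sub_add_cancel]
    · intro x hx
      rw [hf]
      dsimp only
      rw [if_neg hx, zero_mul]
  have hfinite : ∑ x ∈ F, σ x ≠ ⊤ := ENNReal.sum_ne_top.2 fun x _ =>
    ENNReal.mul_ne_top (ENNReal.rpow_ne_top_of_nonneg hq.le (measure_ne_top μ _))
      (ENNReal.rpow_ne_top_of_ne_zero (hw0 x) ENNReal.ofReal_ne_top)
  have hsupp : ∀ ζ, t.Ifun f ζ = (t.Ifun f * (t.Sbar a).indicator (1 : t.Tbar → ℝ≥0∞)) ζ := fun ζ => by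
    by_cases hζ : ζ ∈ t.Sbar a
    · simp [hζ]
    · rw [Pi.mul_apply, indicator_of_notMem hζ, mul_zero, Ifun]
      refine ENNReal.tsum_eq_zero.2 fun y => if_neg fun hy => hζ ?_
      exact mem_PT_iff.1 (mem_PT_of_le (hF _ hy) y.2)
  have hind : ∀ ζ, (t.Sbar a).indicator (1 : t.Tbar → ℝ≥0∞) ζ ^ (p / (p - 1)) =
      (t.Sbar a).indicator 1 ζ := fun ζ => by
    by_cases hζ : ζ ∈ t.Sbar a
    · simp [hζ]
    · simp [hζ, hq]
  have hmain : ∑ x ∈ F, σ x ≤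
      t.Istar μ a ^ (1 / (p / (p - 1))) * B ^ (1 / p) * (∑ x ∈ F, σ x) ^ (1 / p) := by
    calc ∑ x ∈ F, σ x = ∫⁻ ζ, (t.Ifun f * (t.Sbar a).indicator (1 : t.Tbar → ℝ≥0∞)) ζ ∂μ := by
          rw [← hmass]
          exact lintegral_congr hsupp
      _ ≤ (∫⁻ ζ, t.Ifun f ζ ^ p ∂μ) ^ (1 / p) *
          (∫⁻ ζ, (t.Sbar a).indicator 1 ζ ^ (p / (p - 1)) ∂μ) ^ (1 / (p / (p - 1))) :=
          ENNReal.lintegral_mul_le_Lp_mul_Lq μ hpq (measurable_Ifun f).aemeasurable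
            (measurable_one.indicator (measurableSet_Sbar a)).aemeasurable
      _ ≤ (B * ∑ x ∈ F, σ x) ^ (1 / p) * t.Istar μ a ^ (1 / (p / (p - 1))) := by
          simp_rw [hind]
          rw [lintegral_indicator_one (measurableSet_Sbar a)]
          exact mul_le_mul_left (ENNReal.rpow_le_rpow (henergy ▸ h f) (by positivity)) _
      _ = _ := by
          rw [ENNReal.mul_rpow_of_nonneg _ _ (by positivity)]
          ring
  refine (ENNReal.le_rpow_of_le_mul_rpow hpq.symm hfinite hmain).trans_eq ?_
  rw [ENNReal.mul_rpow_of_nonneg _ _ hq.le, ← ENNReal.rpow_mul, ← ENNReal.rpow_mul,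
    one_div_mul_cancel hq.ne', ENNReal.rpow_one,
    show 1 / p * (p / (p - 1)) = (p - 1)⁻¹ by field_simp]

theorem CC_le_of_lintegral_le {π : t.V → ℝ} (hπ : ∀ x, 0 < π x) {p : ℝ} (hp : 1 < p)
    (μ : Measure t.Tbar) [IsFiniteMeasure μ] {B : ℝ≥0∞}
    (h : ∀ f : t.V → ℝ≥0∞,
      ∫⁻ ζ, t.Ifun f ζ ^ p ∂μ ≤ B * ∑' x, f x ^ p * ENNReal.ofReal (π x)) :
    t.CC π p μ ≤ B := by
  refine iSup₂_le fun a ha => ?_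
  rw [← ENNReal.le_rpow_inv_iff (by linarith), ENNReal.div_le_iff' ha.ne' (measure_ne_top μ _),
    sigmaSum, ENNReal.tsum_eq_iSup_sum]
  refine iSup_le fun s => ?_
  have hs := sum_rpow_div_le_of_lintegral_le hπ hp μ h (a := a)
    (F := s.map (Function.Embedding.subtype _)) (by
      intro x hx
      obtain ⟨y, -, rfl⟩ := Finset.mem_map.1 hx
      exact y.2)
  rwa [Finset.sum_map] at hs

end

end PTTree

/-- Trace/Carleson measure theorem on trees: there is `C(p)` depending only on
`p` such that `∫ (If)^p dμ ≤ C(p) [μ] Σ_x f(x)^p π(x)` for all `f ≥ 0`; conversely, if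
`∫ (If)^p dμ ≤ B Σ_x f(x)^p π(x)` for all `f ≥ 0`, then `[μ] ≤ B`. -/
theorem tree_carleson_measures (p : ℝ) (hp : 1 < p) :
    ∃ C : ℝ, 0 < C ∧
      ∀ (t : PTTree) (π : t.V → ℝ), (∀ x : t.V, 0 < π x) →
        ∀ μ : @Measure t.Tbar t.borelT, IsFiniteMeasure μ →
          ((t.CC π p μ < ⊤ →
              ∀ f : t.V → ℝ≥0∞,
                ∫⁻ ζ, t.Ifun f ζ ^ p ∂μ ≤
                  ENNReal.ofReal C * t.CC π p μ *
                    ∑' x : t.V, f x ^ p * ENNReal.ofReal (π x)) ∧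
            ∀ B : ℝ≥0∞, B < ⊤ →
              (∀ f : t.V → ℝ≥0∞,
                ∫⁻ ζ, t.Ifun f ζ ^ p ∂μ ≤ B * ∑' x : t.V, f x ^ p * ENNReal.ofReal (π x)) →
              t.CC π p μ ≤ B) := by
  refine ⟨p ^ p, Real.rpow_pos_of_pos (by linarith) p, fun t π hπ μ hμ => ⟨fun _ f => ?_,
    fun B _ h => ?_⟩⟩
  · exact PTTree.lintegral_Ifun_rpow_le hπ hp μ f
  · exact PTTree.CC_le_of_lintegral_le hπ hp μ h
end

section
/- For every ζ₀ ∈ T̄: Cap({ζ₀}) = d_π(ζ₀)^{1−p}, with the convention that Cap({ζ₀}) = 0 when d_π(ζ₀) = ∞. In particular, for ζ₀ ∈ ∂T, Cap({ζ₀}) > 0 if and only if d_π(ζ₀) < ∞. -/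
open MeasureTheory Set
open scoped ENNReal

/-- Hölder's inequality for sums, as a lower bound on a weighted `p`-energy. -/
theorem ENNReal.tsum_rpow_le_of_one_le_tsum {ι : Type*} {p q : ℝ} (hpq : p.HolderConjugate q)
    (w φ : ι → ℝ≥0∞) (hw0 : ∀ i, w i ≠ 0) (hwt : ∀ i, w i ≠ ⊤) (hφ : 1 ≤ ∑' i, φ i) :
    (∑' i, w i ^ (1 - q)) ^ (1 - p) ≤ ∑' i, φ i ^ p * w i := by
  have hp0 := hpq.pos
  have hp1 := hpq.lt
  have hexp : -(p⁻¹) * q = 1 - q := by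
    have := hpq.symm.sub_one_mul_conj
    field_simp
    linarith
  have holder : ∑' i, φ i ≤
      (∑' i, φ i ^ p * w i) ^ (1 / p) * (∑' i, w i ^ (1 - q)) ^ (1 / q) := by
    let _ : MeasurableSpace ι := ⊤
    have h := ENNReal.lintegral_mul_le_Lp_mul_Lq (Measure.count : Measure ι) hpq
      (f := fun i => φ i * w i ^ p⁻¹) (g := fun i => w i ^ (-(p⁻¹)))
      measurable_from_top.aemeasurable measurable_from_top.aemeasurable
    simp only [lintegral_count, Pi.mul_apply] at h
    convert h using 5 with i i i
    · rw [mul_assoc, ← ENNReal.rpow_add _ _ (hw0 i) (hwt i)]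
      simp
    · rw [ENNReal.mul_rpow_of_nonneg _ _ hp0.le, ← ENNReal.rpow_mul,
        inv_mul_cancel₀ hp0.ne', ENNReal.rpow_one]
    · rw [← ENNReal.rpow_mul, hexp]
  have key := ENNReal.rpow_le_rpow (hφ.trans holder) hp0.le
  rw [ENNReal.one_rpow, ENNReal.mul_rpow_of_nonneg _ _ hp0.le, ← ENNReal.rpow_mul,
    ← ENNReal.rpow_mul, one_div_mul_cancel hp0.ne', ENNReal.rpow_one, one_div_mul_eq_div,
    hpq.div_conj_eq_sub_one] at key
  rw [← neg_sub p 1, ENNReal.rpow_neg, ← one_div]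
  exact ENNReal.div_le_of_le_mul key

namespace PTTree

theorem PT_nonempty (t : PTTree) (ζ : t.Tbar) : (t.PT ζ).Nonempty := by
  rcases ζ with x | ξ
  · exact ⟨x, 0, rfl⟩
  · exact ⟨ξ.1 0, 0, rfl⟩

theorem le_Cap_singleton (t : PTTree) (π : t.V → ℝ) (hπ : ∀ x : t.V, 0 < π x) (p : ℝ)
    (hp : 1 < p) (ζ : t.Tbar) : t.dpi π p ζ ^ (1 - p) ≤ t.Cap π p {ζ} := by
  refine le_iInf₂ fun φ hφ => ?_
  refine (ENNReal.tsum_rpow_le_of_one_le_tsum (Real.HolderConjugate.conjExponent hp)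
    (fun y : t.PT ζ => ENNReal.ofReal (π y)) (fun y => φ y) (fun y => by simp [hπ])
    (fun y => ENNReal.ofReal_ne_top) (hφ ζ rfl)).trans ?_
  exact ENNReal.tsum_comp_le_tsum_of_injective Subtype.val_injective
    fun x => φ x ^ p * ENNReal.ofReal (π x)

/-- Testing the capacity with the extremal function of a finite set of predecessors. -/
theorem Cap_singleton_le_sum (t : PTTree) (π : t.V → ℝ) (hπ : ∀ x : t.V, 0 < π x) (p : ℝ)
    (hp : 1 < p) (ζ : t.Tbar) (F : Finset (t.PT ζ)) (hF : F.Nonempty) :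
    t.Cap π p {ζ} ≤ (∑ y ∈ F, ENNReal.ofReal (π y) ^ (1 - p / (p - 1))) ^ (1 - p) := by
  classical
  have hp1 : p - 1 ≠ 0 := (sub_pos.2 hp).ne'
  have hw0 : ∀ x, ENNReal.ofReal (π x) ≠ 0 := fun x => by simp [hπ]
  have hwt : ∀ x, ENNReal.ofReal (π x) ≠ ⊤ := fun x => ENNReal.ofReal_ne_top
  set w : t.V → ℝ≥0∞ := fun x => ENNReal.ofReal (π x)
  set e : ℝ := 1 - p / (p - 1)
  have he : e * p + 1 = e := by simp only [e]; field_simp; ring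
  set s : ℝ≥0∞ := ∑ y ∈ F, w y ^ e
  have hs0 : s ≠ 0 := by
    obtain ⟨y, hy⟩ := hF
    exact (lt_of_lt_of_le (ENNReal.rpow_pos (pos_iff_ne_zero.2 (hw0 y)) (hwt y))
      (Finset.single_le_sum (f := fun y : t.PT ζ => w y ^ e) (fun _ _ => zero_le) hy)).ne'
  have hst : s ≠ ⊤ := ENNReal.sum_ne_top.2 fun y _ => ENNReal.rpow_ne_top_of_ne_zero (hw0 y) (hwt y)
  let G : Finset t.V := F.map (Function.Embedding.subtype _)
  have hG : ∑ x ∈ G, w x ^ e = s := Finset.sum_map _ _ _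
  let φ : t.V → ℝ≥0∞ := fun x => if x ∈ G then w x ^ e * s⁻¹ else 0
  have hφ : ∀ ξ ∈ ({ζ} : Set t.Tbar), 1 ≤ t.Ifun φ ξ := by
    rintro _ rfl
    calc (1 : ℝ≥0∞) = ∑ y ∈ F, w y ^ e * s⁻¹ := by
          rw [← Finset.sum_mul, ENNReal.mul_inv_cancel hs0 hst]
      _ = ∑ y ∈ F, φ y := Finset.sum_congr rfl fun y hy => by simp [φ, G, hy]
      _ ≤ _ := ENNReal.sum_le_tsum F
  refine (iInf₂_le φ hφ).trans_eq ?_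
  calc ∑' x, φ x ^ p * w x = ∑ x ∈ G, φ x ^ p * w x :=
        tsum_eq_sum fun x hx => by simp [φ, hx, (zero_lt_one.trans hp)]
    _ = ∑ x ∈ G, w x ^ e * s⁻¹ ^ p := Finset.sum_congr rfl fun x hx => by
        simp only [φ, hx, if_true]
        rw [ENNReal.mul_rpow_of_nonneg _ _ (zero_lt_one.trans hp).le, ← ENNReal.rpow_mul,
          mul_right_comm]
        nth_rewrite 2 [← ENNReal.rpow_one (w x)]
        rw [← ENNReal.rpow_add _ _ (hw0 x) (hwt x), he]
    _ = s ^ (1 - p) := by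
        rw [← Finset.sum_mul, hG, ENNReal.inv_rpow, ← ENNReal.rpow_neg]
        nth_rewrite 1 [← ENNReal.rpow_one s]
        rw [← ENNReal.rpow_add _ _ hs0 hst, sub_eq_add_neg]

theorem Cap_singleton_le (t : PTTree) (π : t.V → ℝ) (hπ : ∀ x : t.V, 0 < π x) (p : ℝ)
    (hp : 1 < p) (ζ : t.Tbar) : t.Cap π p {ζ} ≤ t.dpi π p ζ ^ (1 - p) := by
  have hlim : Filter.Tendsto
      (fun F : Finset (t.PT ζ) => (∑ y ∈ F, ENNReal.ofReal (π y) ^ (1 - p / (p - 1))) ^ (1 - p))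
      Filter.atTop (nhds (t.dpi π p ζ ^ (1 - p))) :=
    (ENNReal.continuous_rpow_const.tendsto _).comp ENNReal.summable.hasSum
  obtain ⟨y, hy⟩ := t.PT_nonempty ζ
  refine ge_of_tendsto hlim ?_
  filter_upwards [Filter.eventually_ge_atTop {⟨y, hy⟩}] with F hF
  exact t.Cap_singleton_le_sum π hπ p hp ζ F ((Finset.singleton_nonempty _).mono hF)

end PTTree

/-- capacity of points: `Cap({ζ₀}) = d_π(ζ₀)^{1-p}` for every `ζ₀ ∈ T̄` (in
`ℝ≥0∞`, `∞^{1-p} = 0` since `1-p < 0`, which encodes the convention `Cap = 0` when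
`d_π = ∞`); in particular, for `ζ₀ ∈ ∂T`, `Cap({ζ₀}) > 0` iff `d_π(ζ₀) < ∞`. -/
theorem tree_capacity_point
    (t : PTTree) (π : t.V → ℝ) (hπ : ∀ x : t.V, 0 < π x) (p : ℝ) (hp : 1 < p) :
    (∀ ζ₀ : t.Tbar, t.Cap π p {ζ₀} = t.dpi π p ζ₀ ^ (1 - p)) ∧
    ∀ ξ : t.Bdry, (0 < t.Cap π p {t.inB ξ} ↔ t.dpi π p (t.inB ξ) < ⊤) := by
  have hcap : ∀ ζ : t.Tbar, t.Cap π p {ζ} = t.dpi π p ζ ^ (1 - p) := fun ζ =>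
    (t.Cap_singleton_le π hπ p hp ζ).antisymm (t.le_Cap_singleton π hπ p hp ζ)
  refine ⟨hcap, fun ξ => ?_⟩
  rw [hcap, pos_iff_ne_zero, lt_top_iff_ne_top, not_iff_not, ENNReal.rpow_eq_zero_iff]
  constructor
  · rintro (⟨-, h⟩ | ⟨h, -⟩)
    · linarith
    · exact h
  · exact fun h => Or.inr ⟨h, by linarith⟩
end
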